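/- arXiv:1503.03780 — 2 statements merged into one kernel-verified Lean document; each statement's English description precedes it below -/
import Mathlib

section
/- Let k be a field of characteristic zero. For every matrix g = [[a,b],[c,d]] ∈ SL_2(ℤ) there is a k-algebra automorphism σ_g of F = k(x,y) with σ_g(y) = y^a x^c and σ_g(x) = y^b x^d (integer powers taken in F). Each σ_g is a Poisson automorphism of F, it satisfies σ_g(y^m x^n) = y^{am+bn} x^{cm+dn} for all m, n ∈ ℤ, and the assignment g ↦ σ_g defines an action of SL_2(ℤ) on F by Poisson automorphisms, i.e. σ_{g'} ∘ σ_g = σ_{g'g} for all g, g' ∈ SL_2(ℤ) and σ_I is the identity. -/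
noncomputable section

/-- A Poisson bracket on a commutative `k`-algebra `R`: a `k`-bilinear antisymmetric map
satisfying the Jacobi identity and the Leibniz rule in each argument. -/
structure PoissonBracket (k R : Type*) [CommRing k] [CommRing R] [Algebra k R] where
  bracket : R →ₗ[k] R →ₗ[k] R
  antisymm : ∀ a b : R, bracket a b = - bracket b a
  jacobi : ∀ a b c : R,
    bracket a (bracket b c) + bracket b (bracket c a) + bracket c (bracket a b) = 0
  leibniz : ∀ a b c : R, bracket a (b * c) = bracket a b * c + b * bracket a c

section GeneratorsOfFields

variable {k F ι : Type*} [Field k] [Field F] [Algebra k F]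

theorem Algebra.IsAlgebraic.of_intermediateField_adjoin_eq_top {s : Set F}
    (hs : IntermediateField.adjoin k s = ⊤) : Algebra.IsAlgebraic (Algebra.adjoin k s) F where
  isAlgebraic z := by
    have hz : z ∈ IntermediateField.adjoin k s := hs ▸ IntermediateField.mem_top
    obtain ⟨p, hp, q, hq, rfl⟩ := IntermediateField.mem_adjoin_iff_div.mp hz
    rw [div_eq_mul_inv]
    exact (isAlgebraic_algebraMap (⟨p, hp⟩ : Algebra.adjoin k s)).mul
      (isAlgebraic_algebraMap (⟨q, hq⟩ : Algebra.adjoin k s)).inv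

/-- If a field is purely transcendental on a finite family, then every generating family
indexed by the same type is algebraically independent. -/
theorem AlgebraicIndependent.of_adjoin_range_eq_top [Finite ι] {u v : ι → F}
    (hu : AlgebraicIndependent k u) (hv : IntermediateField.adjoin k (Set.range v) = ⊤) :
    AlgebraicIndependent k v := by
  have := Algebra.IsAlgebraic.of_intermediateField_adjoin_eq_top hv
  exact (Algebra.IsAlgebraic.isTranscendenceBasis_of_lift_le_trdeg_of_finite k v
    hu.lift_cardinalMk_le_trdeg).1

/-- The isomorphism of the rational function field with a field generated by an algebraically
independent family. -/
def AlgebraicIndependent.fractionRingEquiv {u : ι → F} (hu : AlgebraicIndependent k u)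
    (hu' : IntermediateField.adjoin k (Set.range u) = ⊤) :
    FractionRing (MvPolynomial ι k) ≃ₐ[k] F :=
  hu.aevalEquivField.trans
    ((IntermediateField.equivOfEq hu').trans IntermediateField.topEquiv)

theorem AlgebraicIndependent.fractionRingEquiv_X {u : ι → F} (hu : AlgebraicIndependent k u)
    (hu' : IntermediateField.adjoin k (Set.range u) = ⊤) (i : ι) :
    hu.fractionRingEquiv hu' (algebraMap (MvPolynomial ι k) _ (MvPolynomial.X i)) = u i :=
  (hu.aevalEquivField_algebraMap_apply_coe _).trans (MvPolynomial.aeval_X u i)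

theorem AlgebraicIndependent.exists_algEquiv [Finite ι] {u v : ι → F}
    (hu : AlgebraicIndependent k u) (hu' : IntermediateField.adjoin k (Set.range u) = ⊤)
    (hv : IntermediateField.adjoin k (Set.range v) = ⊤) :
    ∃ e : F ≃ₐ[k] F, ∀ i, e (u i) = v i := by
  refine ⟨(hu.fractionRingEquiv hu').symm.trans
    ((hu.of_adjoin_range_eq_top hv).fractionRingEquiv hv), fun i ↦ ?_⟩
  rw [AlgEquiv.trans_apply, ← hu.fractionRingEquiv_X hu' i, AlgEquiv.symm_apply_apply,
    fractionRingEquiv_X]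

theorem AlgEquiv.apply_eq_of_adjoin_eq_top {s : Set F} (hs : IntermediateField.adjoin k s = ⊤)
    {f g : F ≃ₐ[k] F} (h : ∀ a ∈ s, f a = g a) (a : F) : f a = g a := by
  have ha : a ∈ IntermediateField.adjoin k s := hs ▸ IntermediateField.mem_top
  induction ha using IntermediateField.adjoin_induction with
  | mem a ha => exact h a ha
  | algebraMap c => simp
  | add a b _ _ iha ihb => rw [map_add, map_add, iha, ihb]
  | inv a _ iha => rw [map_inv₀, map_inv₀, iha]
  | mul a b _ _ iha ihb => rw [map_mul, map_mul, iha, ihb]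

end GeneratorsOfFields

namespace PoissonBracket

variable {k F : Type*} [Field k] [Field F] [Algebra k F] (P : PoissonBracket k F)

/-- The Hamiltonian derivation `{a, ·}`. -/
def hamiltonian (a : F) : Derivation k F F :=
  Derivation.mk' (P.bracket a) fun b c ↦ by
    rw [P.leibniz, smul_eq_mul, smul_eq_mul]; ring

@[simp]
theorem hamiltonian_apply (a b : F) : P.hamiltonian a b = P.bracket a b := rfl

theorem bracket_self [CharZero k] (a : F) : P.bracket a a = 0 := by
  have : CharZero F := charZero_of_injective_algebraMap (algebraMap k F).injective
  exact self_eq_neg.mp (P.antisymm a a)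

theorem bracket_zpow (a b : F) (hb : b ≠ 0) (n : ℤ) :
    P.bracket a (b ^ n) = n * b ^ n * b⁻¹ * P.bracket a b := by
  rw [← hamiltonian_apply, Derivation.leibniz_zpow, zpow_sub_one₀ hb]
  simp [mul_assoc]

theorem bracket_zpow_mul_zpow {x y : F} (hx : x ≠ 0) (hy : y ≠ 0) (a : F) (m n : ℤ) :
    P.bracket a (y ^ m * x ^ n) =
      (m * y⁻¹ * P.bracket a y + n * x⁻¹ * P.bracket a x) * (y ^ m * x ^ n) := by
  rw [P.leibniz, P.bracket_zpow a y hy, P.bracket_zpow a x hx]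
  ring

/-- Monomials in log-canonical coordinates are log-canonical. -/
theorem bracket_monomials [CharZero k] {x y : F} (hx : x ≠ 0) (hy : y ≠ 0)
    (hP : P.bracket y x = y * x) (a b c d : ℤ) :
    P.bracket (y ^ a * x ^ c) (y ^ b * x ^ d) =
      (a * d - b * c : ℤ) * (y ^ a * x ^ c * (y ^ b * x ^ d)) := by
  rw [P.bracket_zpow_mul_zpow hx hy, P.antisymm _ y, P.antisymm _ x,
    P.bracket_zpow_mul_zpow hx hy y, P.bracket_zpow_mul_zpow hx hy x, P.bracket_self,
    P.bracket_self, P.antisymm x y, hP]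
  push_cast
  field_simp
  ring

/-- Compatibility of an automorphism with a Hamiltonian derivation can be checked on field
generators. -/
theorem map_bracket_of_forall_mem {s : Set F} (hs : IntermediateField.adjoin k s = ⊤)
    (e : F ≃ₐ[k] F) (a : F) (h : ∀ b ∈ s, e (P.bracket a b) = P.bracket (e a) (e b)) (b : F) :
    e (P.bracket a b) = P.bracket (e a) (e b) := by
  have hb : b ∈ IntermediateField.adjoin k s := hs ▸ IntermediateField.mem_top
  induction hb using IntermediateField.adjoin_induction with
  | mem b hb => exact h b hb
  | algebraMap c => rw [AlgEquiv.commutes]; simp [← hamiltonian_apply]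
  | add b c _ _ ihb ihc => simp only [map_add, ihb, ihc]
  | inv b _ ihb =>
    rw [map_inv₀ e, ← hamiltonian_apply, ← hamiltonian_apply, Derivation.leibniz_inv,
      Derivation.leibniz_inv]
    simp [ihb]
  | mul b c _ _ ihb ihc => simp only [P.leibniz, map_add, map_mul, ihb, ihc]

theorem map_bracket_of_generators [CharZero k] {x y : F}
    (hgen : IntermediateField.adjoin k {x, y} = ⊤) (e : F ≃ₐ[k] F)
    (h : e (P.bracket y x) = P.bracket (e y) (e x)) (a b : F) :
    e (P.bracket a b) = P.bracket (e a) (e b) := by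
  have hy := P.map_bracket_of_forall_mem hgen e y (by
    rintro b (rfl | rfl)
    · exact h
    · simp [bracket_self])
  have hx := P.map_bracket_of_forall_mem hgen e x (by
    rintro b (rfl | rfl)
    · simp [bracket_self]
    · rw [P.antisymm, map_neg, h, ← P.antisymm])
  refine P.map_bracket_of_forall_mem hgen e a ?_ b
  rintro b (rfl | rfl)
  · rw [P.antisymm, map_neg, hx, ← P.antisymm]
  · rw [P.antisymm, map_neg, hy, ← P.antisymm]

end PoissonBracket

section Monomials

variable {F : Type*} [Field F] {x y : F}

theorem monomials_zpow_mul_zpow (hx : x ≠ 0) (hy : y ≠ 0) (a b c d m n : ℤ) :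
    (y ^ a * x ^ c) ^ m * (y ^ b * x ^ d) ^ n =
      y ^ (a * m + b * n) * x ^ (c * m + d * n) := by
  rw [mul_zpow, mul_zpow, zpow_add₀ hy, zpow_add₀ hx, zpow_mul, zpow_mul, zpow_mul, zpow_mul]
  ring

theorem adjoin_monomials_eq_top {k : Type*} [Field k] [Algebra k F] (hx : x ≠ 0) (hy : y ≠ 0)
    (hgen : IntermediateField.adjoin k {x, y} = ⊤) {a b c d : ℤ} (hdet : a * d - b * c = 1) :
    IntermediateField.adjoin k {y ^ b * x ^ d, y ^ a * x ^ c} = ⊤ := by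
  rw [eq_top_iff, ← hgen, IntermediateField.adjoin_le_iff]
  have hX := IntermediateField.subset_adjoin k {y ^ b * x ^ d, y ^ a * x ^ c} (Or.inl rfl)
  have hY := IntermediateField.subset_adjoin k {y ^ b * x ^ d, y ^ a * x ^ c} (Or.inr rfl)
  have key (m n : ℤ) := mul_mem (zpow_mem hY m) (zpow_mem hX n)
  simp only [monomials_zpow_mul_zpow hx hy] at key
  rintro z (rfl | rfl)
  · have := key (-b) a
    rwa [show a * -b + b * a = 0 by ring, show c * -b + d * a = 1 by linarith, zpow_zero,
      zpow_one, one_mul] at this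
  · have := key d (-c)
    rwa [show a * d + b * -c = 1 by linarith, show c * d + d * -c = 0 by ring, zpow_zero,
      zpow_one, mul_one] at this

end Monomials

/-- Let `k` be a field of characteristic zero and let `F = k(x,y)` carry the
Poisson bracket with `{y,x} = yx`.  For every `g = [[a,b],[c,d]] ∈ SL₂(ℤ)` there is a
`k`-algebra automorphism `σ_g` of `F` with `σ_g(y) = yᵃxᶜ`, `σ_g(x) = yᵇxᵈ`; each `σ_g` is a
Poisson automorphism satisfying `σ_g(yᵐxⁿ) = y^{am+bn} x^{cm+dn}` for all `m, n ∈ ℤ`, and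
`g ↦ σ_g` is an action of `SL₂(ℤ)` on `F`, i.e. `σ_{g'} ∘ σ_g = σ_{g'g}` and `σ_1 = id`. -/
theorem statement6
    (k : Type*) [Field k] [CharZero k]
    (F : Type*) [Field F] [Algebra k F] (x y : F)
    (hind : AlgebraicIndependent k ![x, y])
    (hgen : IntermediateField.adjoin k {x, y} = ⊤)
    (P : PoissonBracket k F) (hP : P.bracket y x = y * x) :
    ∃ σ : Matrix.SpecialLinearGroup (Fin 2) ℤ → F ≃ₐ[k] F,
      (∀ g : Matrix.SpecialLinearGroup (Fin 2) ℤ, σ g y = y ^ g 0 0 * x ^ g 1 0) ∧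
      (∀ g : Matrix.SpecialLinearGroup (Fin 2) ℤ, σ g x = y ^ g 0 1 * x ^ g 1 1) ∧
      (∀ (g : Matrix.SpecialLinearGroup (Fin 2) ℤ) (a b : F),
        σ g (P.bracket a b) = P.bracket (σ g a) (σ g b)) ∧
      (∀ (g : Matrix.SpecialLinearGroup (Fin 2) ℤ) (m n : ℤ),
        σ g (y ^ m * x ^ n) = y ^ (g 0 0 * m + g 0 1 * n) * x ^ (g 1 0 * m + g 1 1 * n)) ∧
      (∀ (g g' : Matrix.SpecialLinearGroup (Fin 2) ℤ) (a : F),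
        σ g' (σ g a) = σ (g' * g) a) ∧
      (∀ a : F, σ 1 a = a) := by
  have hx : x ≠ 0 := hind.ne_zero 0
  have hy : y ≠ 0 := hind.ne_zero 1
  have hdet (g : Matrix.SpecialLinearGroup (Fin 2) ℤ) : g 0 0 * g 1 1 - g 0 1 * g 1 0 = 1 :=
    (Matrix.det_fin_two g.1).symm.trans g.2
  have hex (g : Matrix.SpecialLinearGroup (Fin 2) ℤ) : ∃ e : F ≃ₐ[k] F,
      e x = y ^ g 0 1 * x ^ g 1 1 ∧ e y = y ^ g 0 0 * x ^ g 1 0 := by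
    obtain ⟨e, he⟩ := hind.exists_algEquiv (v := ![y ^ g 0 1 * x ^ g 1 1, y ^ g 0 0 * x ^ g 1 0])
      (by simpa [Matrix.range_cons, Set.pair_comm] using hgen)
      (by simpa [Matrix.range_cons, Set.pair_comm] using
        adjoin_monomials_eq_top hx hy hgen (hdet g))
    exact ⟨e, he 0, he 1⟩
  choose σ hσx hσy using hex
  have hmon (g : Matrix.SpecialLinearGroup (Fin 2) ℤ) (m n : ℤ) : σ g (y ^ m * x ^ n) =
      y ^ (g 0 0 * m + g 0 1 * n) * x ^ (g 1 0 * m + g 1 1 * n) := by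
    rw [map_mul, map_zpow₀, map_zpow₀, hσx, hσy, monomials_zpow_mul_zpow hx hy]
  refine ⟨σ, hσy, hσx, fun g ↦ P.map_bracket_of_generators hgen (σ g) ?_, hmon,
    fun g g' ↦ ?_, ?_⟩
  · rw [hσx, hσy, P.bracket_monomials hx hy hP, hdet, hP, map_mul, hσx, hσy, Int.cast_one,
      one_mul]
  · refine AlgEquiv.apply_eq_of_adjoin_eq_top (f := (σ g).trans (σ g')) hgen ?_
    rintro a (rfl | rfl)
    · rw [AlgEquiv.trans_apply, hσx, hmon, hσx]
      simp [Matrix.mul_apply, Fin.sum_univ_two]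
    · rw [AlgEquiv.trans_apply, hσy, hmon, hσy]
      simp [Matrix.mul_apply, Fin.sum_univ_two]
  · refine AlgEquiv.apply_eq_of_adjoin_eq_top (g := AlgEquiv.refl) hgen ?_
    rintro a (rfl | rfl)
    · simp [hσx]
    · simp [hσy]
end
end

section
/- Let k be a field of characteristic zero and n ≥ 1. There is a Poisson algebra isomorphism θ : O(SL_n)[z, z^{-1}] → O(GL_n) determined by θ(x̄_{1j}) = x_{1j}·Det^{-1} for 1 ≤ j ≤ n, θ(x̄_{ij}) = x_{ij} for 2 ≤ i ≤ n and 1 ≤ j ≤ n, and θ(z) = Det, where x̄_{ij} denotes the image of x_{ij} in O(SL_n). That is, θ is a bijective k-algebra homomorphism satisfying θ({a,b}) = {θ(a),θ(b)} for all a, b. -/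
noncomputable section

open MvPolynomial

/-- The coordinate ring `O(M_n)` of `n × n` matrices: the polynomial ring on the `n²`
variables `x_{ij}`. -/
abbrev MatrixCoordRing (k : Type*) [Field k] (n : ℕ) : Type _ :=
  MvPolynomial (Fin n × Fin n) k

/-- The determinant of the generic `n × n` matrix `(x_{ij})`. -/
def genericDet (k : Type*) [Field k] (n : ℕ) : MatrixCoordRing k n :=
  (Matrix.of fun i j : Fin n => (X (i, j) : MatrixCoordRing k n)).det

/-- The coordinate ring `O(SL_n) = O(M_n)/(Det − 1)`. -/
abbrev SLCoordRing (k : Type*) [Field k] (n : ℕ) : Type _ :=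
  MatrixCoordRing k n ⧸ Ideal.span {genericDet k n - 1}

namespace PoissonBracket

section Basic

variable {k R : Type*} [CommRing k] [CommRing R] [Algebra k R] (P : PoissonBracket k R)

lemma leibniz_left (a b c : R) :
    P.bracket (a * b) c = P.bracket a c * b + a * P.bracket b c := by
  rw [P.antisymm, P.leibniz, P.antisymm c a, P.antisymm c b]
  ring

lemma bracket_one (a : R) : P.bracket a 1 = 0 := by
  have h := P.leibniz a 1 1
  simpa using h

lemma bracket_algebraMap (a : R) (r : k) : P.bracket a (algebraMap k R r) = 0 := by
  rw [Algebra.algebraMap_eq_smul_one, map_smul, P.bracket_one, smul_zero]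

lemma algebraMap_bracket (a : R) (r : k) : P.bracket (algebraMap k R r) a = 0 := by
  rw [P.antisymm, P.bracket_algebraMap, neg_zero]

/-- The elements which Poisson commute with `a`. -/
def commutant (a : R) : Subalgebra k R where
  carrier := {b | P.bracket a b = 0}
  mul_mem' {x y} hx hy := by
    simp only [Set.mem_ofPred_eq] at hx hy ⊢
    rw [P.leibniz, hx, hy, zero_mul, mul_zero, add_zero]
  add_mem' {x y} hx hy := by
    simp only [Set.mem_ofPred_eq] at hx hy ⊢
    rw [map_add, hx, hy, add_zero]
  algebraMap_mem' r := P.bracket_algebraMap a r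

lemma mem_commutant {a b : R} : b ∈ P.commutant a ↔ P.bracket a b = 0 := Iff.rfl

lemma bracket_eq_zero_of_mul_eq_one {a b : R} (hab : a * b = 1)
    (ha : ∀ c, P.bracket a c = 0) (c : R) : P.bracket b c = 0 := by
  have h := P.leibniz_left a b c
  rw [hab, P.antisymm, P.bracket_one, ha, zero_mul, zero_add, neg_zero] at h
  calc P.bracket b c = (a * b) * P.bracket b c := by rw [hab, one_mul]
    _ = b * (a * P.bracket b c) := by ring
    _ = 0 := by rw [← h, mul_zero]

lemma bracket_pow_eq_zero {a : R} (ha : ∀ c, P.bracket a c = 0) (p : ℕ) (c : R) :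
    P.bracket (a ^ p) c = 0 := by
  rw [P.antisymm, neg_eq_zero]
  exact (P.commutant c).pow_mem (P.mem_commutant.2 (by rw [P.antisymm, ha, neg_zero])) p

lemma bracket_mul_mul_of_central {c d : R} (hc : ∀ x, P.bracket c x = 0)
    (hd : ∀ x, P.bracket d x = 0) (a b : R) :
    P.bracket (a * c) (b * d) = P.bracket a b * (c * d) := by
  rw [P.leibniz_left, P.leibniz, hc, P.antisymm a d, hd]
  ring

end Basic

section Maps

variable {k R S : Type*} [CommRing k] [CommRing R] [CommRing S] [Algebra k R] [Algebra k S]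
  (P : PoissonBracket k R) (Q : PoissonBracket k S)

/-- The elements `a` for which `θ` is compatible with bracketing by `b`. -/
def compatible (θ : R →ₐ[k] S) (b : R) : Subalgebra k R where
  carrier := {a | θ (P.bracket a b) = Q.bracket (θ a) (θ b)}
  mul_mem' {x y} hx hy := by
    simp only [Set.mem_ofPred_eq] at hx hy ⊢
    rw [P.leibniz_left, map_mul, Q.leibniz_left, map_add, map_mul, map_mul, hx, hy]
  add_mem' {x y} hx hy := by
    simp only [Set.mem_ofPred_eq] at hx hy ⊢
    simp only [map_add, LinearMap.add_apply, hx, hy]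
  algebraMap_mem' r := by
    simp [algebraMap_bracket]

lemma mem_compatible {θ : R →ₐ[k] S} {a b : R} :
    a ∈ P.compatible Q θ b ↔ θ (P.bracket a b) = Q.bracket (θ a) (θ b) := Iff.rfl

lemma mem_compatible_comm {θ : R →ₐ[k] S} {a b : R} :
    a ∈ P.compatible Q θ b ↔ b ∈ P.compatible Q θ a := by
  rw [mem_compatible, mem_compatible, P.antisymm, Q.antisymm, map_neg, neg_inj]

/-- An algebra homomorphism is Poisson as soon as it is so on generators. -/
lemma map_bracket_of_adjoin_eq_top {θ : R →ₐ[k] S} {s : Set R} (hs : Algebra.adjoin k s = ⊤)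
    (h : ∀ a ∈ s, ∀ b ∈ s, θ (P.bracket a b) = Q.bracket (θ a) (θ b)) (a b : R) :
    θ (P.bracket a b) = Q.bracket (θ a) (θ b) := by
  have key (c : R) (hc : s ⊆ P.compatible Q θ c) (x : R) : x ∈ P.compatible Q θ c :=
    Algebra.adjoin_le hc (hs ▸ Algebra.mem_top)
  exact key b (fun x hx => (P.mem_compatible_comm Q).1 (key x (fun y hy => h y hy x hx) b)) a

/-- `f` is homogeneous of degree `p`, and `{f, x}` of degree `p + q`, in the sense that `φ` and
`ι` agree on them up to the corresponding power of `D`. -/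
def IsScaled (φ ι : R →ₐ[k] S) (D : S) (x : R) (q p : ℕ) (f : R) : Prop :=
  φ f * D ^ p = ι f ∧ φ (P.bracket f x) * D ^ (p + q) = ι (P.bracket f x)

variable {P} {φ ι : R →ₐ[k] S} {D : S} {x : R} {q : ℕ}

lemma IsScaled.one : P.IsScaled φ ι D x q 0 1 := by
  refine ⟨by simp, ?_⟩
  rw [P.antisymm, P.bracket_one]
  simp

lemma IsScaled.mul {p r : ℕ} {f g : R} (hf : P.IsScaled φ ι D x q p f)
    (hg : P.IsScaled φ ι D x q r g) : P.IsScaled φ ι D x q (p + r) (f * g) := by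
  refine ⟨by rw [map_mul, map_mul, ← hf.1, ← hg.1]; ring, ?_⟩
  rw [P.leibniz_left, map_add, map_mul, map_mul, map_add, map_mul, map_mul,
    ← hf.1, ← hg.1, ← hf.2, ← hg.2]
  ring

lemma IsScaled.prod {τ : Type*} (s : Finset τ) {p : τ → ℕ} {f : τ → R}
    (h : ∀ i ∈ s, P.IsScaled φ ι D x q (p i) (f i)) :
    P.IsScaled φ ι D x q (∑ i ∈ s, p i) (∏ i ∈ s, f i) := by
  classical
  induction s using Finset.induction_on with
  | empty => simpa using IsScaled.one
  | insert i s hi ih =>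
    rw [Finset.sum_insert hi, Finset.prod_insert hi]
    exact (h i (Finset.mem_insert_self i s)).mul
      (ih fun j hj => h j (Finset.mem_insert_of_mem hj))

lemma IsScaled.sum {τ : Type*} (s : Finset τ) {p : ℕ} {f : τ → R}
    (h : ∀ i ∈ s, P.IsScaled φ ι D x q p (f i)) :
    P.IsScaled φ ι D x q p (∑ i ∈ s, f i) := by
  constructor
  · simp only [map_sum, Finset.sum_mul]
    exact Finset.sum_congr rfl fun i hi => (h i hi).1
  · simp only [map_sum, Finset.sum_mul, LinearMap.sum_apply]
    exact Finset.sum_congr rfl fun i hi => (h i hi).2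

lemma IsScaled.intUnit_smul {p : ℕ} {f : R} (u : ℤˣ) (h : P.IsScaled φ ι D x q p f) :
    P.IsScaled φ ι D x q p (u • f) := by
  rcases Int.units_eq_one_or u with rfl | rfl
  · simpa using h
  · simpa [IsScaled] using h

lemma IsScaled.det {m : Type*} [Fintype m] [DecidableEq m] {w : m → ℕ} {M : Matrix m m R}
    (h : ∀ i j, P.IsScaled φ ι D x q (w i) (M i j)) :
    P.IsScaled φ ι D x q (∑ i, w i) M.det := by
  rw [Matrix.det_apply]
  refine IsScaled.sum _ fun σ _ => IsScaled.intUnit_smul _ ?_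
  rw [← Equiv.sum_comp σ w]
  exact IsScaled.prod _ fun i _ => h (σ i) i

end Maps

end PoissonBracket

/-- The degree, with respect to the first row, of the entries in row `i`. -/
def firstRowDegree {n : ℕ} (i : Fin n) : ℕ := if (i : ℕ) = 0 then 1 else 0

lemma sum_firstRowDegree {n : ℕ} (hn : 1 ≤ n) : ∑ i : Fin n, firstRowDegree i = 1 := by
  obtain ⟨m, rfl⟩ : ∃ m, n = m + 1 := ⟨n - 1, by omega⟩
  simp [firstRowDegree]

/-- The standard bracket of two generators is homogeneous with respect to the first row. -/
lemma map_bracket_X_X {k S : Type*} [Field k] [CharZero k] {n : ℕ} [CommRing S] [Algebra k S]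
    (P : PoissonBracket k (MatrixCoordRing k n))
    (hProw : ∀ i j m : Fin n, j < m →
      P.bracket (X (i, j)) (X (i, m)) = X (i, j) * X (i, m))
    (hPcol : ∀ i l j : Fin n, i < l →
      P.bracket (X (i, j)) (X (l, j)) = X (i, j) * X (l, j))
    (hPanti : ∀ i l j m : Fin n, i < l → j < m →
      P.bracket (X (i, m)) (X (l, j)) = 0)
    (hPdiag : ∀ i l j m : Fin n, i < l → j < m →
      P.bracket (X (i, j)) (X (l, m)) = 2 * (X (i, m) * X (l, j)))
    (φ ι : MatrixCoordRing k n →ₐ[k] S) (D : S)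
    (hφ : ∀ i j, φ (X (i, j)) * D ^ firstRowDegree i = ι (X (i, j))) (i j l m : Fin n) :
    φ (P.bracket (X (i, j)) (X (l, m))) * D ^ (firstRowDegree i + firstRowDegree l)
      = ι (P.bracket (X (i, j)) (X (l, m))) := by
  have hmul (i j l m : Fin n) : φ (X (i, j) * X (l, m)) * D ^ (firstRowDegree i + firstRowDegree l)
      = ι (X (i, j) * X (l, m)) := by
    rw [map_mul, map_mul, ← hφ, ← hφ, pow_add]
    ring
  have hswap (i j l m : Fin n)
      (h : φ (P.bracket (X (i, j)) (X (l, m))) * D ^ (firstRowDegree i + firstRowDegree l)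
        = ι (P.bracket (X (i, j)) (X (l, m)))) :
      φ (P.bracket (X (l, m)) (X (i, j))) * D ^ (firstRowDegree l + firstRowDegree i)
        = ι (P.bracket (X (l, m)) (X (i, j))) := by
    rw [P.antisymm, map_neg, map_neg, add_comm, neg_mul, h]
  have hlt (i j l m : Fin n) (hil : i < l) :
      φ (P.bracket (X (i, j)) (X (l, m))) * D ^ (firstRowDegree i + firstRowDegree l)
        = ι (P.bracket (X (i, j)) (X (l, m))) := by
    rcases lt_trichotomy j m with hjm | rfl | hjm
    · rw [hPdiag i l j m hil hjm, map_mul, mul_assoc, hmul, map_mul ι 2, map_ofNat, map_ofNat]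
    · rw [hPcol i l j hil, hmul]
    · rw [hPanti i l m j hil hjm, map_zero, map_zero, zero_mul]
  rcases lt_trichotomy i l with hil | rfl | hil
  · exact hlt i j l m hil
  · rcases lt_trichotomy j m with hjm | rfl | hjm
    · rw [hProw i j m hjm, hmul]
    · rw [self_eq_neg.1 (P.antisymm (X (i, j)) (X (i, j))), map_zero, map_zero, zero_mul]
    · exact hswap i m i j (by rw [hProw i m j hjm, hmul])
  · exact hswap l m i j (hlt l m i j hil)

/-- `O(SL_n)[z,z⁻¹]` is generated by `z`, `z⁻¹` and the matrix entries. -/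
lemma adjoin_laurent_SLCoordRing (k : Type*) [Field k] (n : ℕ) :
    Algebra.adjoin k ({LaurentPolynomial.T 1, LaurentPolynomial.T (-1)} ∪
      Set.range fun v : Fin n × Fin n => LaurentPolynomial.C
        (Ideal.Quotient.mk (Ideal.span {genericDet k n - 1}) (X v)) :
      Set (LaurentPolynomial (SLCoordRing k n))) = ⊤ := by
  set s : Set (LaurentPolynomial (SLCoordRing k n)) := _ ∪ _ with hs
  have hT (m : ℤ) : (LaurentPolynomial.T m : LaurentPolynomial (SLCoordRing k n)) ∈
      Algebra.adjoin k s := by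
    rcases m.eq_nat_or_neg with ⟨p, rfl | rfl⟩
    · have h := (Algebra.adjoin k s).pow_mem (Algebra.subset_adjoin
        (show LaurentPolynomial.T 1 ∈ s from Or.inl (Or.inl rfl))) p
      simpa using h
    · have h := (Algebra.adjoin k s).pow_mem (Algebra.subset_adjoin
        (show LaurentPolynomial.T (-1) ∈ s from Or.inl (Or.inr rfl))) p
      simpa using h
  have hC (a : SLCoordRing k n) : LaurentPolynomial.C a ∈ Algebra.adjoin k s := by
    obtain ⟨f, rfl⟩ := Ideal.Quotient.mk_surjective a
    induction f using MvPolynomial.induction_on with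
    | C c => exact (Algebra.adjoin k s).algebraMap_mem c
    | add p q hp hq => rw [map_add, map_add]; exact add_mem hp hq
    | mul_X p v hp =>
      rw [map_mul, map_mul]
      exact mul_mem hp (Algebra.subset_adjoin (Or.inr ⟨v, rfl⟩))
  refine top_unique fun p _ => ?_
  induction p using LaurentPolynomial.induction_on' with
  | add p q hp hq => exact add_mem (hp trivial) (hq trivial)
  | C_mul_T m a => exact mul_mem (hC a) (hT m)

/-- Let `k` be a field of characteristic zero and `n ≥ 1`.  There is a
Poisson algebra isomorphism `θ : O(SL_n)[z,z⁻¹] → O(GL_n)` with `θ(x̄_{1j}) = x_{1j}·Det⁻¹`,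
`θ(x̄_{ij}) = x_{ij}` for `i ≥ 2`, and `θ(z) = Det`.  Here `O(M_n)` carries the standard
Poisson bracket (given below on generators), `O(GL_n)` is the localization of `O(M_n)` away
from `Det` with the (unique) extended bracket, `O(SL_n)` carries the induced bracket, and
`z = T 1` is Poisson central in the Laurent extension.  (Row `1` corresponds to the index
`i : Fin n` with `(i : ℕ) = 0`, and `θ(x̄_{1j}) = x_{1j}·Det⁻¹` is recorded in the
equivalent form `θ(x̄_{1j})·Det = x_{1j}`, `Det` being invertible in `O(GL_n)`.) -/
theorem statement8
    (k : Type*) [Field k] [CharZero k] (n : ℕ) (hn : 1 ≤ n)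
    (P : PoissonBracket k (MatrixCoordRing k n))
    (hProw : ∀ i j m : Fin n, j < m →
      P.bracket (X (i, j)) (X (i, m)) = X (i, j) * X (i, m))
    (hPcol : ∀ i l j : Fin n, i < l →
      P.bracket (X (i, j)) (X (l, j)) = X (i, j) * X (l, j))
    (hPanti : ∀ i l j m : Fin n, i < l → j < m →
      P.bracket (X (i, m)) (X (l, j)) = 0)
    (hPdiag : ∀ i l j m : Fin n, i < l → j < m →
      P.bracket (X (i, j)) (X (l, m)) = 2 * (X (i, m) * X (l, j)))
    -- `Gln` (= O(GL_n)) is the localization `O(GL_n) = O(M_n)[Det⁻¹]`,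
    -- with the Poisson bracket extending that of `O(M_n)`:
    (Gln : Type*) [CommRing Gln] [Algebra k Gln] [Algebra (MatrixCoordRing k n) Gln]
    [IsScalarTower k (MatrixCoordRing k n) Gln]
    [IsLocalization.Away (genericDet k n) Gln]
    (Pgl : PoissonBracket k Gln)
    (hPgl : ∀ a b : MatrixCoordRing k n,
      Pgl.bracket (algebraMap (MatrixCoordRing k n) Gln a) (algebraMap (MatrixCoordRing k n) Gln b)
        = algebraMap (MatrixCoordRing k n) Gln (P.bracket a b))
    -- `O(SL_n)` with its induced Poisson bracket:
    (Psl : PoissonBracket k (SLCoordRing k n))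
    (hPsl : ∀ a b : MatrixCoordRing k n,
      Psl.bracket (Ideal.Quotient.mk (Ideal.span {genericDet k n - 1}) a)
          (Ideal.Quotient.mk (Ideal.span {genericDet k n - 1}) b)
        = Ideal.Quotient.mk (Ideal.span {genericDet k n - 1}) (P.bracket a b))
    -- `O(SL_n)[z,z⁻¹]` with the Poisson bracket extending that of `O(SL_n)`,
    -- in which `z = T 1` is Poisson central:
    (PL : PoissonBracket k (LaurentPolynomial (SLCoordRing k n)))
    (hPLC : ∀ a b : SLCoordRing k n,
      PL.bracket (LaurentPolynomial.C a) (LaurentPolynomial.C b)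
        = LaurentPolynomial.C (Psl.bracket a b))
    (hPLz : ∀ a : LaurentPolynomial (SLCoordRing k n), PL.bracket (LaurentPolynomial.T 1) a = 0) :
    ∃ θ : LaurentPolynomial (SLCoordRing k n) ≃ₐ[k] Gln,
      (∀ i j : Fin n, (i : ℕ) = 0 →
        θ (LaurentPolynomial.C (Ideal.Quotient.mk (Ideal.span {genericDet k n - 1}) (X (i, j))))
            * algebraMap (MatrixCoordRing k n) Gln (genericDet k n)
          = algebraMap (MatrixCoordRing k n) Gln (X (i, j))) ∧
      (∀ i j : Fin n, (i : ℕ) ≠ 0 →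
        θ (LaurentPolynomial.C (Ideal.Quotient.mk (Ideal.span {genericDet k n - 1}) (X (i, j))))
          = algebraMap (MatrixCoordRing k n) Gln (X (i, j))) ∧
      θ (LaurentPolynomial.T 1) = algebraMap (MatrixCoordRing k n) Gln (genericDet k n) ∧
      (∀ a b : LaurentPolynomial (SLCoordRing k n),
        θ (PL.bracket a b) = Pgl.bracket (θ a) (θ b)) := by
  set I : Ideal (MatrixCoordRing k n) := Ideal.span {genericDet k n - 1} with hI
  set ι : MatrixCoordRing k n →ₐ[k] Gln := IsScalarTower.toAlgHom k (MatrixCoordRing k n) Gln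
  have hι (a : MatrixCoordRing k n) : algebraMap (MatrixCoordRing k n) Gln a = ι a := rfl
  simp only [hι] at hPgl ⊢
  have hunit : IsUnit (ι (genericDet k n)) := IsLocalization.Away.algebraMap_isUnit _
  obtain ⟨D, hD⟩ := hunit
  -- The homomorphism dividing the first row by the determinant.
  let φ : MatrixCoordRing k n →ₐ[k] Gln :=
    aeval fun v => ι (X v) * (↑D⁻¹ : Gln) ^ firstRowDegree v.1
  have hφ (i j : Fin n) : φ (X (i, j)) * (D : Gln) ^ firstRowDegree i = ι (X (i, j)) := by
    simp only [φ, aeval_X]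
    rw [mul_assoc, ← mul_pow, Units.inv_mul, one_pow, mul_one]
  have hφX := map_bracket_X_X P hProw hPcol hPanti hPdiag φ ι D hφ
  have hdet (v : Fin n × Fin n) :
      P.IsScaled φ ι (D : Gln) (X v) (firstRowDegree v.1) 1 (genericDet k n) := by
    rw [← sum_firstRowDegree hn]
    exact PoissonBracket.IsScaled.det fun i j => ⟨hφ i j, hφX i j v.1 v.2⟩
  have hφdet : φ (genericDet k n) = 1 := by
    have h := (hdet (⟨0, hn⟩, ⟨0, hn⟩)).1
    rw [← hD, pow_one] at h
    exact D.isUnit.mul_eq_right.1 h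
  have hφI (a : MatrixCoordRing k n) (ha : a ∈ I) : φ a = 0 := by
    have hle : I ≤ RingHom.ker φ := by
      rw [hI, Ideal.span_singleton_le_iff_mem, RingHom.mem_ker, map_sub, hφdet, map_one, sub_self]
    exact hle ha
  -- The determinant is Poisson central.
  have hmkdet : Ideal.Quotient.mk I (genericDet k n) = 1 := by
    rw [← map_one (Ideal.Quotient.mk I), Ideal.Quotient.eq]
    exact Ideal.subset_span rfl
  have hdetX (v : Fin n × Fin n) : Pgl.bracket D (ι (X v)) = 0 := by
    have h0 : P.bracket (genericDet k n) (X v) ∈ I := by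
      rw [← Ideal.Quotient.eq_zero_iff_mem, ← hPsl, hmkdet, Psl.antisymm, Psl.bracket_one, neg_zero]
    rw [hD, hPgl, ← (hdet v).2, hφI _ h0, zero_mul]
  have hdetι (a : MatrixCoordRing k n) : Pgl.bracket D (ι a) = 0 := by
    have h : Algebra.adjoin k (Set.range X) ≤ (Pgl.commutant (D : Gln)).comap ι := by
      refine Algebra.adjoin_le ?_
      rintro _ ⟨v, rfl⟩
      exact hdetX v
    rw [adjoin_range_X] at h
    exact h (Algebra.mem_top (x := a))
  have hDcentral (y : Gln) : Pgl.bracket D y = 0 := by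
    obtain ⟨p, a, ha⟩ := IsLocalization.Away.surj (genericDet k n) y
    rw [hι, hι, ← hD] at ha
    have h := Pgl.leibniz D y ((D : Gln) ^ p)
    rw [ha, hdetι, hD, ← map_pow, ← hD, hdetι, mul_zero, add_zero, map_pow, ← hD] at h
    exact ((D.isUnit.pow p).mul_left_eq_zero).1 h.symm
  have hDinvcentral (y : Gln) : Pgl.bracket (↑D⁻¹ : Gln) y = 0 :=
    Pgl.bracket_eq_zero_of_mul_eq_one D.mul_inv hDcentral y
  have hφP (u v : Fin n × Fin n) :
      φ (P.bracket (X u) (X v)) = Pgl.bracket (φ (X u)) (φ (X v)) := by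
    have hDpow := Pgl.bracket_pow_eq_zero hDcentral
    have h := hφX u.1 u.2 v.1 v.2
    rw [← hPgl, ← hφ, ← hφ, Pgl.bracket_mul_mul_of_central (hDpow _) (hDpow _), ← pow_add] at h
    exact (D.isUnit.pow _).mul_right_cancel h
  -- The homomorphism `θ`.
  let φbar : SLCoordRing k n →ₐ[k] Gln := Ideal.Quotient.liftₐ I φ hφI
  let θ : LaurentPolynomial (SLCoordRing k n) →ₐ[k] Gln :=
    { LaurentPolynomial.eval₂ φbar.toRingHom D with
      commutes' := fun r => by
        change LaurentPolynomial.eval₂ φbar.toRingHom D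
          (LaurentPolynomial.C (algebraMap k (SLCoordRing k n) r)) = _
        rw [LaurentPolynomial.eval₂_C]
        exact φbar.commutes r }
  have hθC (a : MatrixCoordRing k n) :
      θ (LaurentPolynomial.C (Ideal.Quotient.mk I a)) = φ a :=
    LaurentPolynomial.eval₂_C φbar.toRingHom D _
  have hθT (m : ℤ) : θ (LaurentPolynomial.T m) = (D ^ m : Glnˣ) :=
    LaurentPolynomial.eval₂_T φbar.toRingHom D m
  -- Its inverse.
  let z (m : ℤ) : LaurentPolynomial (SLCoordRing k n) := LaurentPolynomial.T m
  let C' : MatrixCoordRing k n →ₐ[k] LaurentPolynomial (SLCoordRing k n) :=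
    (Algebra.ofId (SLCoordRing k n) (LaurentPolynomial (SLCoordRing k n))).restrictScalars k
      |>.comp (Ideal.Quotient.mkₐ k I)
  have hC' (a : MatrixCoordRing k n) : C' a = LaurentPolynomial.C (Ideal.Quotient.mk I a) := rfl
  let ψ₀ : MatrixCoordRing k n →ₐ[k] LaurentPolynomial (SLCoordRing k n) :=
    aeval fun v => z 1 ^ firstRowDegree v.1 * C' (X v)
  have hψ₀X (i j : Fin n) : ψ₀ (X (i, j)) = z 1 ^ firstRowDegree i * C' (X (i, j)) :=
    aeval_X _ _
  have hψ₀det : ψ₀ (genericDet k n) = z 1 := by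
    have h := Matrix.det_mul_column (fun i : Fin n => z 1 ^ firstRowDegree i)
      (C'.mapMatrix (Matrix.of fun i j : Fin n => (X (i, j) : MatrixCoordRing k n)))
    rw [← AlgHom.map_det, Finset.prod_pow_eq_pow_sum, sum_firstRowDegree hn, pow_one] at h
    change _ = z 1 * C' (genericDet k n) at h
    rw [hC', hmkdet, map_one, mul_one] at h
    rw [← h]
    refine (AlgHom.map_det (S := MatrixCoordRing k n)
      (T := LaurentPolynomial (SLCoordRing k n)) ψ₀
      (Matrix.of fun i j : Fin n => X (i, j))).trans ?_
    congr 1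
    ext1 i j
    exact hψ₀X i j
  have hz : z 1 * z (-1) = 1 := by
    simp only [z]
    rw [← LaurentPolynomial.T_add, add_neg_cancel, LaurentPolynomial.T_zero]
  have hψ₀unit : IsUnit (ψ₀ (genericDet k n)) := by
    rw [hψ₀det]
    exact ⟨⟨z 1, z (-1), hz, (mul_comm (z (-1)) (z 1)).trans hz⟩, rfl⟩
  let ψ : Gln →ₐ[k] LaurentPolynomial (SLCoordRing k n) :=
    IsLocalization.Away.liftAlgHom (P := LaurentPolynomial (SLCoordRing k n)) (f := ψ₀)
      (genericDet k n) hψ₀unit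
  have hψι (a : MatrixCoordRing k n) : ψ (ι a) = ψ₀ a :=
    IsLocalization.Away.lift_eq (genericDet k n) hψ₀unit a
  have hψD : ψ D = z 1 := by rw [hD, hψι, hψ₀det]
  have hψDinv : ψ (↑D⁻¹ : Gln) = z (-1) := by
    have h : ψ (↑D⁻¹ : Gln) * z 1 = 1 := by rw [← hψD, ← map_mul, Units.inv_mul, map_one]
    exact left_inv_eq_right_inv h hz
  have hθψ : θ.comp ψ = AlgHom.id k Gln := by
    have h : (θ.comp ψ).comp ι = ι := by
      refine MvPolynomial.algHom_ext fun v => ?_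
      change θ (ψ (ι (X v))) = ι (X v)
      rw [hψι, hψ₀X v.1 v.2, map_mul, map_pow, hθT, hC', hθC, zpow_one, mul_comm]
      exact hφ v.1 v.2
    apply AlgHom.coe_ringHom_injective
    refine IsLocalization.ringHom_ext (Submonoid.powers (genericDet k n)) ?_
    exact congrArg AlgHom.toRingHom h
  have hψθ : ψ.comp θ = AlgHom.id k (LaurentPolynomial (SLCoordRing k n)) := by
    refine AlgHom.ext_of_adjoin_eq_top (adjoin_laurent_SLCoordRing k n) ?_
    rintro _ ((rfl | rfl) | ⟨v, rfl⟩)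
    · change ψ (θ _) = _
      rw [hθT, zpow_one, hψD]
      rfl
    · change ψ (θ _) = _
      rw [hθT, zpow_neg_one, hψDinv]
      rfl
    · change ψ (θ _) = C' (X v)
      have h : φ (X v) = ι (X v) * (↑D⁻¹ : Gln) ^ firstRowDegree v.1 := aeval_X _ _
      rw [hθC, h, map_mul, map_pow, hψι, hψDinv, hψ₀X v.1 v.2,
        mul_right_comm (z 1 ^ firstRowDegree v.1), ← mul_pow (z 1), hz, one_pow, one_mul]
  have hzinv (a : LaurentPolynomial (SLCoordRing k n)) : PL.bracket (z (-1)) a = 0 :=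
    PL.bracket_eq_zero_of_mul_eq_one hz hPLz a
  refine ⟨AlgEquiv.ofAlgHom θ ψ hθψ hψθ, fun i j hi => ?_, fun i j hi => ?_, ?_, ?_⟩
  · have h := hφ i j
    rw [firstRowDegree, if_pos hi, pow_one, hD] at h
    rw [← h]
    exact congrArg (· * _) (hθC _)
  · have h := hφ i j
    rw [firstRowDegree, if_neg hi, pow_zero, mul_one] at h
    exact (hθC _).trans h
  · exact (hθT 1).trans (by rw [zpow_one, hD])
  · have hT₁ (b) : z 1 ∈ PL.compatible Pgl θ b := by
      rw [PL.mem_compatible, hPLz, map_zero, hθT, zpow_one, hDcentral]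
    have hT₂ (b) : z (-1) ∈ PL.compatible Pgl θ b := by
      rw [PL.mem_compatible, hzinv, map_zero, hθT, zpow_neg_one, hDinvcentral]
    refine PL.map_bracket_of_adjoin_eq_top Pgl (θ := θ) (adjoin_laurent_SLCoordRing k n) ?_
    rintro _ ((rfl | rfl) | ⟨u, rfl⟩) b hb
    · exact hT₁ b
    · exact hT₂ b
    · rcases hb with (rfl | rfl) | ⟨v, rfl⟩
      · exact (PL.mem_compatible_comm Pgl).1 (hT₁ _)
      · exact (PL.mem_compatible_comm Pgl).1 (hT₂ _)
      · rw [hPLC, hPsl, hθC, hθC, hθC]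
        exact hφP u v
end
end
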